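/- arXiv:1212.0441 — 6 statements merged into one kernel-verified Lean document; each statement's English description precedes it below -/
import Mathlib

section
/- The series ∑_{n=1}^∞ [ψ(n + 1/2) − log n] converges and ∑_{n=1}^∞ [ψ(n + 1/2) − log n] = γ/2 + (1/2)·log(2/π). -/
open Real Filter MeasureTheory Topology

/-- The digamma function `ψ(x) = Γ'(x)/Γ(x)`. -/
noncomputable def digamma (x : ℝ) : ℝ := deriv Real.Gamma x / Real.Gamma x

lemma digamma_add_one_aux (x : ℝ) (hx : 0 < x) : digamma (x + 1) = digamma x + 1 / x := by
  have hd : ∀ y : ℝ, 0 < y → DifferentiableAt ℝ Real.Gamma y := fun y hy =>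
    Real.differentiableAt_Gamma (fun m => by
      have : (0 : ℝ) ≤ m := Nat.cast_nonneg m
      linarith)
  have h1 : HasDerivAt (fun y => Real.Gamma (y + 1)) (deriv Real.Gamma (x + 1)) x := by
    have := (hd (x + 1) (by linarith)).hasDerivAt
    exact this.comp_add_const x 1
  have h2 : HasDerivAt (fun y => y * Real.Gamma y)
      (1 * Real.Gamma x + x * deriv Real.Gamma x) x :=
    (hasDerivAt_id x).mul (hd x hx).hasDerivAt
  have h3 : (fun y => Real.Gamma (y + 1)) =ᶠ[𝓝 x] fun y => y * Real.Gamma y := by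
    filter_upwards [lt_mem_nhds hx] with y hy
    exact Real.Gamma_add_one hy.ne'
  have h4 := (h2.congr_of_eventuallyEq h3).unique h1
  have hG := (Real.Gamma_pos_of_pos hx).ne'
  unfold digamma
  rw [← h4, Real.Gamma_add_one hx.ne']
  field_simp
  ring

lemma digamma_half_aux : digamma (1 / 2) = - Real.eulerMascheroniConstant - 2 * Real.log 2 := by
  unfold digamma
  rw [Real.hasDerivAt_Gamma_one_half.deriv, Real.Gamma_one_half_eq]
  have : √π ≠ 0 := by positivity
  field_simp
  ring

lemma digamma_nat_half_aux (n : ℕ) : digamma ((n : ℝ) + 1 / 2) =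
    - Real.eulerMascheroniConstant - 2 * Real.log 2 + 2 * (harmonic (2 * n) : ℝ)
      - (harmonic n : ℝ) := by
  induction n with
  | zero => simp [← digamma_half_aux]
  | succ k ih =>
    have e : ((k + 1 : ℕ) : ℝ) + 1 / 2 = ((k : ℝ) + 1 / 2) + 1 := by push_cast; ring
    rw [e, digamma_add_one_aux _ (by positivity), ih,
      show 2 * (k + 1) = 2 * k + 1 + 1 by ring, harmonic_succ, harmonic_succ, harmonic_succ]
    push_cast
    field_simp
    ring

/-- The (shifted) summand. -/
noncomputable def dAux (n : ℕ) : ℝ := digamma (((n : ℝ) + 1) + 1 / 2) - Real.log ((n : ℝ) + 1)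

lemma dAux_tendsto : Tendsto dAux atTop (𝓝 0) := by
  have h1 := Real.tendsto_harmonic_sub_log
  have h2 : Tendsto (fun n : ℕ => 2 * n) atTop atTop :=
    tendsto_id.const_mul_atTop' (by norm_num)
  have h3 := h1.comp h2
  have h4 := (((h3.const_mul 2).sub h1).add_const
    (- Real.eulerMascheroniConstant)).comp (tendsto_add_atTop_nat 1)
  have e : 2 * Real.eulerMascheroniConstant - Real.eulerMascheroniConstant
    + - Real.eulerMascheroniConstant = 0 := by ring
  rw [e] at h4
  refine h4.congr (fun n => ?_)
  have h5 := digamma_nat_half_aux (n + 1)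
  have h6 : Real.log (2 * ((n : ℝ) + 1)) = Real.log 2 + Real.log ((n : ℝ) + 1) :=
    Real.log_mul (by norm_num) (by positivity)
  simp only [Function.comp, dAux]
  push_cast at h5 ⊢
  rw [h5, h6]
  ring

lemma stirling_diff_aux (n : ℕ) :
    Real.log (Stirling.stirlingSeq (n + 1)) - Real.log (Stirling.stirlingSeq (n + 2)) =
      ((n : ℝ) + 1 + 1 / 2) * (dAux n - dAux (n + 1)) := by
  have e : (((n + 1 : ℕ) : ℝ) + 1) + 1 / 2 = ((n : ℝ) + 1 + 1 / 2) + 1 := by push_cast; ring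
  unfold dAux
  rw [e, digamma_add_one_aux _ (by positivity), Stirling.log_stirlingSeq_formula,
    Stirling.log_stirlingSeq_formula, Nat.factorial_succ (n + 1)]
  have f : ((n + 1).factorial : ℝ) ≠ 0 := by positivity
  push_cast
  rw [Real.log_mul (by positivity) f]
  have g : (n : ℝ) + 1 + 1 = n + 2 := by ring
  simp only [g]
  rw [Real.log_div (by positivity) (by positivity), Real.log_div (by positivity) (by positivity),
    Real.log_mul (by positivity) (by positivity), Real.log_mul (by positivity) (by positivity),
    Real.log_exp]
  field_simp
  ring

lemma dAux_antitone : Antitone dAux := by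
  refine antitone_nat_of_succ_le (fun n => ?_)
  have h := Stirling.log_stirlingSeq'_antitone (Nat.le_succ n)
  have h2 := stirling_diff_aux n
  simp only [Function.comp, Nat.succ_eq_add_one] at h
  have h3 : 0 ≤ ((n : ℝ) + 1 + 1 / 2) * (dAux n - dAux (n + 1)) := by
    rw [← h2]; linarith
  have := nonneg_of_mul_nonneg_right h3 (by positivity)
  linarith

lemma dAux_nonneg (n : ℕ) : 0 ≤ dAux n := dAux_antitone.le_of_tendsto dAux_tendsto n

lemma dAux_le (n : ℕ) : dAux n ≤ 1 / ((n : ℝ) + 1) ^ 2 := by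
  have hm : Monotone (fun n : ℕ => dAux n - 1 / ((n : ℝ) + 1) ^ 2) := by
    refine monotone_nat_of_le_succ (fun n => ?_)
    have h := Stirling.log_stirlingSeq_sub_log_stirlingSeq_succ (n + 1)
    rw [stirling_diff_aux n] at h
    have h3 : ((n : ℝ) + 1 + 1 / 2) * (1 / (4 * ((n : ℝ) + 1) ^ 2) / ((n : ℝ) + 1 + 1 / 2))
        = 1 / (4 * ((n : ℝ) + 1) ^ 2) := by field_simp
    have h4 : dAux n - dAux (n + 1) ≤ 1 / (4 * ((n : ℝ) + 1) ^ 2) / ((n : ℝ) + 1 + 1 / 2) := by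
      refine le_of_mul_le_mul_left ?_ (show (0 : ℝ) < (n : ℝ) + 1 + 1 / 2 by positivity)
      rw [h3]; push_cast at h; exact h
    have h5 : 1 / (4 * ((n : ℝ) + 1) ^ 2) / ((n : ℝ) + 1 + 1 / 2) ≤
        1 / ((n : ℝ) + 1) ^ 2 - 1 / ((n : ℝ) + 1 + 1) ^ 2 := by
      rw [div_div, div_sub_div _ _ (by positivity) (by positivity),
        div_le_div_iff₀ (by positivity) (by positivity)]
      have hn : (0 : ℝ) ≤ n := Nat.cast_nonneg n
      rw [← sub_nonneg]
      ring_nf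
      positivity
    push_cast
    linarith
  have ht : Tendsto (fun n : ℕ => dAux n - 1 / ((n : ℝ) + 1) ^ 2) atTop (𝓝 0) := by
    have h := tendsto_one_div_add_atTop_nhds_zero_nat (𝕜 := ℝ)
    have h2 := dAux_tendsto.sub (h.pow 2)
    simpa using h2
  have := hm.ge_of_tendsto ht n
  linarith

lemma sum_digamma_aux (N : ℕ) : ∑ n ∈ Finset.range N, digamma (((n : ℝ) + 1) + 1 / 2) =
    ((N : ℝ) + 1 / 2) * digamma ((N : ℝ) + 1 / 2) - N - digamma (1 / 2) / 2 := by
  induction N with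
  | zero => simp; ring
  | succ k ih =>
    rw [Finset.sum_range_succ, ih]
    have e : (k : ℝ) + 1 + 1 / 2 = ((k : ℝ) + 1 / 2) + 1 := by ring
    push_cast
    rw [e, digamma_add_one_aux _ (by positivity)]
    field_simp
    ring

lemma sum_log_aux (N : ℕ) : ∑ n ∈ Finset.range N, Real.log ((n : ℝ) + 1) =
    Real.log (N.factorial : ℝ) := by
  induction N with
  | zero => simp
  | succ k ih =>
    rw [Finset.sum_range_succ, ih, Nat.factorial_succ]
    push_cast
    rw [Real.log_mul (by positivity) (by positivity)]
    ring

lemma sum_dAux (N : ℕ) : ∑ n ∈ Finset.range (N + 1), dAux n =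
    ((N : ℝ) + 1 + 1 / 2) * dAux N - Real.log (Stirling.stirlingSeq (N + 1))
      + (Real.eulerMascheroniConstant / 2 + Real.log 2 / 2) := by
  rw [Stirling.log_stirlingSeq_formula]
  unfold dAux
  rw [Finset.sum_sub_distrib, sum_digamma_aux, sum_log_aux, digamma_half_aux]
  push_cast
  rw [Real.log_div (by positivity) (by positivity),
    Real.log_mul (by positivity) (by positivity), Real.log_exp]
  ring

/-- `∑_{n=1}^∞ [ψ(n + 1/2) − log n] = γ/2 + (1/2) log(2/π)`, the series converging. -/
theorem tsum_digamma_add_half_sub_log :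
    HasSum (fun n : ℕ => digamma (((n : ℝ) + 1) + 1 / 2) - Real.log ((n : ℝ) + 1))
      (Real.eulerMascheroniConstant / 2 + (1 / 2) * Real.log (2 / π)) := by
  change HasSum dAux _
  rw [hasSum_iff_tendsto_nat_of_nonneg dAux_nonneg, ← tendsto_add_atTop_iff_nat 1]
  simp only [sum_dAux]
  have h1 : Tendsto (fun N : ℕ => ((N : ℝ) + 1 + 1 / 2) * dAux N) atTop (𝓝 0) := by
    have h := (tendsto_one_div_add_atTop_nhds_zero_nat (𝕜 := ℝ)).const_mul 2
    rw [mul_zero] at h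
    refine squeeze_zero (fun N => mul_nonneg (by positivity) (dAux_nonneg N)) (fun N => ?_) h
    have h2 := dAux_le N
    calc ((N : ℝ) + 1 + 1 / 2) * dAux N ≤ (2 * ((N : ℝ) + 1)) * (1 / ((N : ℝ) + 1) ^ 2) := by
          have hn : (0 : ℝ) ≤ N := Nat.cast_nonneg N
          exact mul_le_mul (by linarith) h2 (dAux_nonneg N) (by positivity)
      _ = 2 * (1 / ((N : ℝ) + 1)) := by field_simp
  have h2 : Tendsto (fun N : ℕ => Real.log (Stirling.stirlingSeq (N + 1))) atTop
      (𝓝 (Real.log √π)) :=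
    (Stirling.tendsto_stirlingSeq_sqrt_pi.comp (tendsto_add_atTop_nat 1)).log (by positivity)
  have h3 := (h1.sub h2).add_const (Real.eulerMascheroniConstant / 2 + Real.log 2 / 2)
  convert h3 using 2
  rw [Real.log_div (by norm_num) (by positivity), Real.log_sqrt (by positivity)]
  ring
end

section
/- For every real x > 0, the series ∑_{n=1}^∞ [ψ(x+n) − ψ(n) − x/(n+x)] converges and equals x. -/
open Real Filter MeasureTheory Topology

lemma diffAt_Gamma {y : ℝ} (hy : 0 < y) : DifferentiableAt ℝ Real.Gamma y :=
  Real.differentiableAt_Gamma (fun m => by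
    have : (0 : ℝ) ≤ m := Nat.cast_nonneg m
    linarith)

lemma deriv_logGamma {y : ℝ} (hy : 0 < y) : deriv (Real.log ∘ Real.Gamma) y = digamma y := by
  have h := (diffAt_Gamma hy).hasDerivAt.log (Real.Gamma_pos_of_pos hy).ne'
  exact h.deriv

lemma digamma_add_one {y : ℝ} (hy : 0 < y) : digamma (y + 1) = digamma y + 1 / y := by
  have hG := (Real.Gamma_pos_of_pos hy).ne'
  have h1 : HasDerivAt (fun t : ℝ => t * Real.Gamma t)
      (1 * Real.Gamma y + y * deriv Real.Gamma y) y :=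
    (hasDerivAt_id y).mul (diffAt_Gamma hy).hasDerivAt
  have h2 : HasDerivAt (fun t : ℝ => Real.Gamma (t + 1)) (deriv Real.Gamma (y + 1)) y :=
    (diffAt_Gamma (by linarith : 0 < y + 1)).hasDerivAt.comp_add_const y 1
  have h3 : (fun t : ℝ => Real.Gamma (t + 1)) =ᶠ[𝓝 y] (fun t : ℝ => t * Real.Gamma t) := by
    filter_upwards [eventually_gt_nhds hy] with t ht
    exact Real.Gamma_add_one ht.ne'
  have h4 := h2.unique (h1.congr_of_eventuallyEq h3)
  unfold digamma
  rw [h4, Real.Gamma_add_one hy.ne']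
  field_simp
  ring

lemma digamma_mono {a b : ℝ} (ha : 0 < a) (hab : a ≤ b) : digamma a ≤ digamma b := by
  have hb : 0 < b := by linarith
  have := Real.convexOn_log_Gamma.monotoneOn_deriv (fun y hy =>
    ((diffAt_Gamma hy).log (Real.Gamma_pos_of_pos hy).ne'))
  rw [← deriv_logGamma ha, ← deriv_logGamma hb]
  exact this ha hb hab

lemma digamma_add_nat {y : ℝ} (hy : 0 < y) (k : ℕ) : digamma (y + k) - digamma y ≤ k / y := by
  induction k with
  | zero => simp
  | succ k ih =>
    have hk : (0 : ℝ) ≤ k := Nat.cast_nonneg k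
    have h := digamma_add_one (by linarith : 0 < y + k)
    have h2 : 1 / (y + k) ≤ 1 / y := one_div_le_one_div_of_le hy (by linarith)
    push_cast
    rw [← add_assoc, h, add_div]
    linarith

/-- For every real `x > 0`, `∑_{n=1}^∞ [ψ(x+n) − ψ(n) − x/(n+x)] = x`,
the series converging. -/
theorem tsum_digamma_shift (x : ℝ) (hx : 0 < x) :
    HasSum (fun n : ℕ =>
        digamma (x + ((n : ℝ) + 1)) - digamma ((n : ℝ) + 1) - x / (((n : ℝ) + 1) + x))
      x := by
  set d : ℕ → ℝ := fun n => digamma (x + ((n : ℝ) + 1)) - digamma ((n : ℝ) + 1) with hd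
  have hrec : ∀ n : ℕ, d (n + 1) = d n + 1 / (x + (n + 1)) - 1 / ((n : ℝ) + 1) := by
    intro n
    have hn : (0 : ℝ) ≤ n := Nat.cast_nonneg n
    simp only [hd]
    push_cast
    rw [digamma_add_one (by linarith : (0 : ℝ) < n + 1), ← add_assoc x,
      digamma_add_one (by linarith : (0 : ℝ) < x + (n + 1))]
    ring
  have hinv : Tendsto (fun n : ℕ => 1 / ((n : ℝ) + 1)) atTop (𝓝 0) :=
    tendsto_one_div_add_atTop_nhds_zero_nat
  have hd0 : Tendsto d atTop (𝓝 0) := by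
    obtain ⟨k, hk⟩ := exists_nat_ge x
    have hu : Tendsto (fun n : ℕ => (k : ℝ) * (1 / ((n : ℝ) + 1))) atTop (𝓝 0) := by
      simpa using hinv.const_mul (k : ℝ)
    refine squeeze_zero (fun n => ?_) (fun n => ?_) hu
    · have hn : (0 : ℝ) ≤ n := Nat.cast_nonneg n
      exact sub_nonneg.2 (digamma_mono (by linarith) (by linarith))
    · have hn : (0 : ℝ) ≤ n := Nat.cast_nonneg n
      have h1 := digamma_add_nat (by linarith : (0 : ℝ) < n + 1) k
      have h2 : digamma (x + ((n : ℝ) + 1)) ≤ digamma ((n : ℝ) + 1 + k) :=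
        digamma_mono (by linarith) (by linarith)
      rw [mul_one_div]
      simp only [hd]
      linarith
  have hlow0 : Tendsto (fun n : ℕ => x / (((n : ℝ) + 1) + x)) atTop (𝓝 0) := by
    refine Tendsto.div_atTop tendsto_const_nhds ?_
    exact tendsto_atTop_add_const_right _ _
      (tendsto_atTop_add_const_right _ _ tendsto_natCast_atTop_atTop)
  have hlow : ∀ n : ℕ, 0 ≤ d n - x / (((n : ℝ) + 1) + x) := by
    have hanti : Antitone (fun n : ℕ => d n - x / (((n : ℝ) + 1) + x)) := by
      refine antitone_nat_of_succ_le (fun n => ?_)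
      have hn : (0 : ℝ) ≤ n := Nat.cast_nonneg n
      rw [hrec]
      push_cast
      rw [← sub_nonneg]
      have : d n - x / ((n : ℝ) + 1 + x) - (d n + 1 / (x + (n + 1)) - 1 / ((n : ℝ) + 1)
          - x / ((n : ℝ) + 1 + 1 + x)) =
          x * (x + 1) / (((n : ℝ) + 1) * (n + 1 + x) * (n + 1 + 1 + x)) := by
        have h1 : (n : ℝ) + 1 + x ≠ 0 := by positivity
        have h2 : (n : ℝ) + 1 ≠ 0 := by positivity
        have h3 : (n : ℝ) + 1 + 1 + x ≠ 0 := by positivity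
        rw [add_comm x ((n : ℝ) + 1)]
        field_simp
        ring
      rw [this]
      positivity
    have ht : Tendsto (fun n : ℕ => d n - x / (((n : ℝ) + 1) + x)) atTop (𝓝 0) := by
      simpa using hd0.sub hlow0
    exact fun n => hanti.le_of_tendsto ht n
  have hup : ∀ n : ℕ, d (n + 1) - x * (1 / ((n : ℝ) + 1)) ≤ 0 := by
    have hmono : Monotone (fun n : ℕ => d (n + 1) - x * (1 / ((n : ℝ) + 1))) := by
      refine monotone_nat_of_le_succ (fun n => ?_)
      have hn : (0 : ℝ) ≤ n := Nat.cast_nonneg n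
      rw [hrec (n + 1)]
      push_cast
      rw [← sub_nonneg]
      have : d (n + 1) + 1 / (x + ((n : ℝ) + 1 + 1)) - 1 / ((n : ℝ) + 1 + 1)
          - x * (1 / ((n : ℝ) + 1 + 1)) - (d (n + 1) - x * (1 / ((n : ℝ) + 1))) =
          x * (x + 1) / (((n : ℝ) + 1) * (n + 1 + 1) * (x + (n + 1 + 1))) := by
        have h1 : x + ((n : ℝ) + 1 + 1) ≠ 0 := by positivity
        have h2 : (n : ℝ) + 1 ≠ 0 := by positivity
        have h3 : (n : ℝ) + 1 + 1 ≠ 0 := by positivity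
        field_simp
        ring
      rw [this]
      positivity
    have ht : Tendsto (fun n : ℕ => d (n + 1) - x * (1 / ((n : ℝ) + 1))) atTop (𝓝 0) := by
      simpa using (hd0.comp (tendsto_add_atTop_nat 1)).sub (hinv.const_mul x)
    exact fun n => hmono.ge_of_tendsto ht n
  have hsum : ∀ N : ℕ, ∑ n ∈ Finset.range N, (d n - x / (((n : ℝ) + 1) + x)) = N * d N := by
    intro N
    induction N with
    | zero => simp
    | succ n ih =>
      rw [Finset.sum_range_succ, ih, hrec]
      push_cast
      have h1 : (n : ℝ) + 1 + x ≠ 0 := by positivity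
      have h2 : (n : ℝ) + 1 ≠ 0 := by positivity
      rw [add_comm x ((n : ℝ) + 1)]
      field_simp
      ring
  rw [hasSum_iff_tendsto_nat_of_nonneg hlow]
  rw [← tendsto_add_atTop_iff_nat 1]
  have hl : Tendsto (fun n : ℕ => x - (x + 1) * (x / (((n : ℝ) + 1 + x)))) atTop (𝓝 x) := by
    simpa using tendsto_const_nhds.sub (hlow0.const_mul (x + 1))
  refine tendsto_of_tendsto_of_tendsto_of_le_of_le hl tendsto_const_nhds
    (fun N => ?_) (fun N => ?_)
  · have h := hsum (N + 1)
    have h1 := hlow (N + 1)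
    show _ ≤ ∑ n ∈ Finset.range (N + 1), (d n - x / (((n : ℝ) + 1) + x))
    rw [h]
    push_cast at h1 ⊢
    have h2 : ((N : ℝ) + 1) * (x / ((N : ℝ) + 1 + 1 + x)) ≤ ((N : ℝ) + 1) * d (N + 1) :=
      mul_le_mul_of_nonneg_left (by linarith) (by positivity)
    refine le_trans ?_ h2
    rw [← sub_nonneg]
    have : ((N : ℝ) + 1) * (x / ((N : ℝ) + 1 + 1 + x)) - (x - (x + 1) * (x / ((N : ℝ) + 1 + x)))
        = x * (x + 1) / (((N : ℝ) + 1 + 1 + x) * ((N : ℝ) + 1 + x)) := by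
      have h3 : (N : ℝ) + 1 + x ≠ 0 := by positivity
      have h4 : (N : ℝ) + 1 + 1 + x ≠ 0 := by positivity
      field_simp
      ring
    rw [this]
    positivity
  · have h := hsum (N + 1)
    have h1 := hup N
    show ∑ n ∈ Finset.range (N + 1), (d n - x / (((n : ℝ) + 1) + x)) ≤ x
    rw [h]
    push_cast
    have h2 : ((N : ℝ) + 1) * d (N + 1) ≤ ((N : ℝ) + 1) * (x * (1 / ((N : ℝ) + 1))) :=
      mul_le_mul_of_nonneg_left (by linarith) (by positivity)
    refine h2.trans (le_of_eq ?_)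
    have h2 : (N : ℝ) + 1 ≠ 0 := by positivity
    field_simp
end

section
/- The series ∑_{n=1}^∞ [log n + n·log(1 + 1/n) − ψ(n) − 1] converges and equals 1/2. -/
open Real Filter MeasureTheory Topology

theorem aux_digamma (n : ℕ) :
    digamma ((n : ℝ) + 1) = (harmonic n : ℝ) - Real.eulerMascheroniConstant := by
  unfold digamma
  rw [Real.deriv_Gamma_nat, Real.Gamma_nat_eq_factorial]
  have : (n.factorial : ℝ) ≠ 0 := by positivity
  field_simp
  ring

theorem aux_log_lower (x : ℝ) (hx : 0 < x) : 2 / (2 * x + 1) ≤ Real.log (1 + 1 / x) := by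
  have h := Real.le_log_one_add_of_nonneg (x := 1 / x) (by positivity)
  refine le_trans (le_of_eq ?_) h
  field_simp
  try ring

theorem aux_log_upper (x : ℝ) (hx : 0 < x) :
    Real.log (1 + 1 / x) ≤ (1 / x + 1 / (x + 1)) / 2 := by
  have h1 : (0 : ℝ) ≤ Real.log (1 + 1 / x) :=
    Real.log_nonneg (by have : 0 < 1 / x := by positivity
                        linarith)
  have h := Real.self_le_sinh_iff.2 h1
  rw [Real.sinh_log (by positivity)] at h
  refine h.trans (le_of_eq ?_)
  field_simp
  ring

theorem aux_log_diff (x : ℝ) (hx : 0 < x) :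
    Real.log (x + 1) = Real.log x + Real.log (1 + 1 / x) := by
  rw [← Real.log_mul (by positivity) (by positivity)]
  congr 1
  field_simp

/-- `e n = log (n+1) - ψ(n+1)`. -/
noncomputable def auxE (n : ℕ) : ℝ :=
  Real.log ((n : ℝ) + 1) - digamma ((n : ℝ) + 1)

theorem auxE_tendsto : Tendsto auxE atTop (𝓝 0) := by
  have h := Real.tendsto_harmonic_sub_log_add_one
  have h2 := h.const_sub Real.eulerMascheroniConstant
  rw [sub_self] at h2
  refine h2.congr fun n => ?_
  rw [auxE, aux_digamma]
  ring

theorem auxE_step (n : ℕ) :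
    auxE (n + 1) = auxE n + Real.log (1 + 1 / ((n : ℝ) + 1)) - 1 / ((n : ℝ) + 1) := by
  rw [auxE, auxE, aux_digamma, aux_digamma, harmonic_succ]
  push_cast
  rw [aux_log_diff ((n : ℝ) + 1) (by positivity)]
  ring

theorem auxE_lower (n : ℕ) : 1 / (2 * ((n : ℝ) + 1)) ≤ auxE n := by
  have anti : Antitone fun n : ℕ => auxE n - 1 / (2 * ((n : ℝ) + 1)) := by
    refine antitone_nat_of_succ_le fun k => ?_
    rw [auxE_step]
    push_cast
    have h := aux_log_upper ((k : ℝ) + 1) (by positivity)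
    have e1 : 1 / (2 * ((k : ℝ) + 1)) = (1 / ((k : ℝ) + 1)) / 2 := by field_simp
    have e2 : 1 / (2 * ((k : ℝ) + 1 + 1)) = (1 / ((k : ℝ) + 1 + 1)) / 2 := by field_simp
    rw [e1, e2]
    linarith
  have lim : Tendsto (fun n : ℕ => auxE n - 1 / (2 * ((n : ℝ) + 1))) atTop (𝓝 0) := by
    have h := (tendsto_one_div_add_atTop_nhds_zero_nat (𝕜 := ℝ)).const_mul (1 / 2)
    have h2 := auxE_tendsto.sub h
    simp only [mul_zero, sub_zero] at h2
    refine h2.congr fun n => ?_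
    field_simp
  have := anti.le_of_tendsto lim n
  linarith

theorem auxE_upper (n : ℕ) : auxE n ≤ 1 / (2 * (n : ℝ) + 1) := by
  have mono : Monotone fun n : ℕ => auxE n - 1 / (2 * (n : ℝ) + 1) := by
    refine monotone_nat_of_le_succ fun k => ?_
    rw [auxE_step]
    push_cast
    have h := aux_log_lower ((k : ℝ) + 1) (by positivity)
    have key : 1 / ((k : ℝ) + 1) + 1 / (2 * ((k : ℝ) + 1) + 1)
        ≤ 2 / (2 * ((k : ℝ) + 1) + 1) + 1 / (2 * (k : ℝ) + 1) := by
      have hk : (0 : ℝ) ≤ k := by positivity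
      rw [div_add_div _ _ (by positivity) (by positivity),
        div_add_div _ _ (by positivity) (by positivity),
        div_le_div_iff₀ (by positivity) (by positivity)]
      nlinarith [mul_nonneg hk hk]
    linarith
  have lim : Tendsto (fun n : ℕ => auxE n - 1 / (2 * (n : ℝ) + 1)) atTop (𝓝 0) := by
    have h := (tendsto_one_div_add_atTop_nhds_zero_nat (𝕜 := ℝ)).comp
      (tendsto_id.const_mul_atTop' (r := 2) (by norm_num))
    have h2 := auxE_tendsto.sub h
    simp only [sub_zero] at h2
    refine h2.congr fun n => ?_
    simp
  have := mono.ge_of_tendsto lim n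
  linarith

theorem aux_partial (N : ℕ) :
    ∑ n ∈ Finset.range N, (Real.log ((n : ℝ) + 1) +
      ((n : ℝ) + 1) * Real.log (1 + 1 / ((n : ℝ) + 1)) - digamma ((n : ℝ) + 1) - 1)
      = N * auxE N := by
  induction N with
  | zero => simp
  | succ k ih =>
    rw [Finset.sum_range_succ, ih, auxE_step]
    have : auxE k = Real.log ((k : ℝ) + 1) - digamma ((k : ℝ) + 1) := rfl
    push_cast
    have hk : (k : ℝ) + 1 ≠ 0 := by positivity
    have e : ((k : ℝ) + 1) * (1 / ((k : ℝ) + 1)) = 1 := by field_simp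
    linear_combination (-1 : ℝ) * this + e

/-- `∑_{n=1}^∞ [log n + n log(1 + 1/n) − ψ(n) − 1] = 1/2`, the series converging. -/
theorem tsum_log_add_mul_log_sub_digamma :
    HasSum (fun n : ℕ =>
        Real.log ((n : ℝ) + 1) + ((n : ℝ) + 1) * Real.log (1 + 1 / ((n : ℝ) + 1)) -
          digamma ((n : ℝ) + 1) - 1)
      (1 / 2) := by
  rw [hasSum_iff_tendsto_nat_of_nonneg]
  · simp only [aux_partial]
    have h0 := tendsto_one_div_add_atTop_nhds_zero_nat (𝕜 := ℝ)
    have hl : Tendsto (fun n : ℕ => 1 / 2 - 1 / 2 * (1 / ((n : ℝ) + 1))) atTop (𝓝 (1 / 2)) := by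
      simpa using (h0.const_mul (1 / 2 : ℝ)).const_sub (1 / 2 : ℝ)
    refine tendsto_of_tendsto_of_tendsto_of_le_of_le hl tendsto_const_nhds ?_ ?_
    · intro n
      have h := mul_le_mul_of_nonneg_left (auxE_lower n) (Nat.cast_nonneg (α := ℝ) n)
      refine le_trans (le_of_eq ?_) h
      field_simp
      ring
    · intro n
      have h := mul_le_mul_of_nonneg_left (auxE_upper n) (Nat.cast_nonneg (α := ℝ) n)
      refine h.trans ?_
      rw [mul_one_div, div_le_div_iff₀ (by positivity) (by norm_num)]
      linarith
  · intro n
    have h1 := auxE_lower n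
    have h2 := mul_le_mul_of_nonneg_left (aux_log_lower ((n : ℝ) + 1) (by positivity))
      (by positivity : (0 : ℝ) ≤ (n : ℝ) + 1)
    have h3 : 1 - 1 / (2 * ((n : ℝ) + 1)) ≤ ((n : ℝ) + 1) * (2 / (2 * ((n : ℝ) + 1) + 1)) := by
      have : ((n : ℝ) + 1) * (2 / (2 * ((n : ℝ) + 1) + 1)) = 1 - 1 / (2 * ((n : ℝ) + 1) + 1) := by
        field_simp
        ring
      rw [this]
      have : 1 / (2 * ((n : ℝ) + 1) + 1) ≤ 1 / (2 * ((n : ℝ) + 1)) :=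
        one_div_le_one_div_of_le (by positivity) (by linarith)
      linarith
    unfold auxE at h1
    linarith
end

section
/- Let a > 0 be real and p ≥ 1 an integer. Then the limit lim_{N→∞} [∑_{n=0}^N (log(a+n))^p/(a+n) − (log(a+N))^{p+1}/(p+1)] exists and equals γ_p(a), the p-th generalized Stieltjes constant, defined by γ_p(a) = (−1)^p · (d^p/ds^p)[ζ(s,a) − 1/(s−1)] evaluated at s = 1, where ζ(s,a) = ∑_{n=0}^∞ 1/(a+n)^s is the Hurwitz zeta function (analytically continued, with 1/(s−1) removing its simple pole at s = 1). -/
open Real Filter MeasureTheory Topology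

noncomputable def Eint (L : ℝ) (z : ℂ) : ℂ := dslope (fun z : ℂ => Complex.exp ((L : ℂ) * z)) 0 z

lemma Eint_zero (L : ℝ) : Eint L 0 = L := by
  unfold Eint
  rw [dslope_same]
  have : HasDerivAt (fun z : ℂ => Complex.exp ((L : ℂ) * z)) (Complex.exp (L * 0) * (L * 1)) 0 :=
    ((hasDerivAt_id (0 : ℂ)).const_mul (L : ℂ)).cexp
  rw [this.deriv]; simp

lemma Eint_ne (L : ℝ) {z : ℂ} (hz : z ≠ 0) : Eint L z = (Complex.exp (L * z) - 1) / z := by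
  unfold Eint
  rw [dslope_of_ne _ hz, slope_def_field]; simp

lemma Eint_mul (L : ℝ) (z : ℂ) : z * Eint L z = Complex.exp (L * z) - 1 := by
  by_cases hz : z = 0
  · simp [hz]
  · rw [Eint_ne L hz]; field_simp

lemma Eint_diff (L : ℝ) : Differentiable ℂ (Eint L) := by
  have := (Complex.differentiableOn_dslope (f := fun z : ℂ => Complex.exp ((L : ℂ) * z))
    (s := Set.univ) (c := 0) univ_mem).2 (by fun_prop)
  exact differentiableOn_univ.1 this

lemma Eint_iter (L : ℝ) (p : ℕ) : iteratedDeriv p (Eint L) 0 = (L : ℂ) ^ (p + 1) / (p + 1) := by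
  have hk : ∀ k : ℕ, ∀ z : ℂ, iteratedDeriv (k + 1) (fun z => z * Eint L z) z
      = z * iteratedDeriv (k + 1) (Eint L) z + (k + 1) * iteratedDeriv k (Eint L) z := by
    have hd : ∀ k : ℕ, Differentiable ℂ (iteratedDeriv k (Eint L)) := fun k =>
      ((Eint_diff L).contDiff (n := ⊤)).differentiable_iteratedDeriv k (by exact_mod_cast WithTop.coe_lt_top _)
    intro k
    induction k with
    | zero =>
      intro z
      have h : HasDerivAt (fun z => z * Eint L z) (1 * Eint L z + z * deriv (Eint L) z) z :=
        (hasDerivAt_id z).mul (Eint_diff L z).hasDerivAt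
      rw [zero_add, iteratedDeriv_one, iteratedDeriv_one, iteratedDeriv_zero, h.deriv]
      push_cast; ring
    | succ k ih =>
      intro z
      rw [iteratedDeriv_succ, funext ih]
      have h : HasDerivAt (fun z => z * iteratedDeriv (k + 1) (Eint L) z
          + (k + 1) * iteratedDeriv k (Eint L) z)
          (1 * iteratedDeriv (k + 1) (Eint L) z + z * deriv (iteratedDeriv (k + 1) (Eint L)) z
            + (k + 1) * deriv (iteratedDeriv k (Eint L)) z) z :=
        ((hasDerivAt_id z).mul (hd (k+1) z).hasDerivAt).add
          ((hd k z).hasDerivAt.const_mul ((k : ℂ) + 1))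
      rw [h.deriv, ← iteratedDeriv_succ, ← iteratedDeriv_succ]
      push_cast; ring
  have h1 := hk p 0
  have h2 : (fun z => z * Eint L z) = fun z => Complex.exp (L * z) - 1 := funext (Eint_mul L)
  have h3 : iteratedDeriv (p + 1) (fun z => Complex.exp (L * z) - 1) 0 = (L : ℂ) ^ (p + 1) := by
    rw [iteratedDeriv_succ']
    have : deriv (fun z : ℂ => Complex.exp (L * z) - 1) = deriv (fun z : ℂ => Complex.exp (L * z)) := by
      ext z; simp
    rw [this, ← iteratedDeriv_succ', iteratedDeriv_cexp_const_mul]; simp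
  rw [h2, h3] at h1
  have : (p : ℂ) + 1 ≠ 0 := by exact_mod_cast Nat.succ_ne_zero p
  rw [h1]; field_simp; simp

lemma Eint_deriv (s : ℂ) {T : ℝ} (hT : 0 < T) :
    HasDerivAt (fun T : ℝ => Eint (Real.log T) (1 - s)) (Complex.exp (-(Real.log T : ℂ) * s)) T := by
  have hl : HasDerivAt (fun T : ℝ => (Real.log T : ℂ)) ((T⁻¹ : ℝ) : ℂ) T :=
    (Real.hasDerivAt_log hT.ne').ofReal_comp
  have hT' : Complex.exp (Real.log T : ℂ) = T := by
    rw [← Complex.ofReal_exp, Real.exp_log hT]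
  have hT0 : (T : ℂ) ≠ 0 := by exact_mod_cast hT.ne'
  by_cases hs : 1 - s = 0
  · simp only [hs, Eint_zero]
    convert hl using 1
    have : s = 1 := by linear_combination -hs
    rw [this, mul_one, Complex.exp_neg, hT']; simp
  · simp only [Eint_ne _ hs]
    have := (((hl.mul_const (1 - s)).cexp.sub_const 1).div_const (1 - s))
    refine this.congr_deriv ?_
    have h1 : Complex.exp ((Real.log T : ℂ) * (1 - s)) = T * Complex.exp (-(Real.log T : ℂ) * s) := by
      rw [← hT']
      rw [← Complex.exp_add]
      congr 1; ring
    rw [h1]; push_cast; field_simp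

lemma norm_term (s : ℂ) {T : ℝ} (hT : 0 < T) :
    ‖Complex.exp (-(Real.log T : ℂ) * s)‖ = T ^ (-s.re) := by
  rw [Complex.norm_exp, Real.rpow_def_of_pos hT]; simp

lemma term_diff_bound (s : ℂ) (h1 : 1 / 2 ≤ s.re) (h2 : s.re ≤ 3 / 2) {m x : ℝ} (hm : 0 < m)
    (hx : x ∈ Set.Icc m (m + 1)) :
    ‖Complex.exp (-(Real.log x : ℂ) * s) - Complex.exp (-(Real.log (m + 1) : ℂ) * s)‖
      ≤ ‖s‖ * (m ^ (-(3 / 2) : ℝ) + m ^ (-(5 / 2) : ℝ)) := by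
  set C := ‖s‖ * (m ^ (-(3 / 2) : ℝ) + m ^ (-(5 / 2) : ℝ)) with hC
  have hC0 : 0 ≤ C := by positivity
  have key := (convex_Icc m (m + 1)).norm_image_sub_le_of_norm_hasDerivWithin_le
    (f := fun y : ℝ => Complex.exp (-(Real.log y : ℂ) * s))
    (f' := fun y : ℝ => Complex.exp (-(Real.log y : ℂ) * s) * (-((y⁻¹ : ℝ) : ℂ) * s)) (C := C)
    (x := m + 1) (y := x) ?_ ?_ (by constructor <;> linarith) hx
  · refine key.trans ?_
    have : ‖x - (m + 1)‖ ≤ 1 := by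
      rw [Real.norm_eq_abs, abs_le]; constructor <;> linarith [hx.1, hx.2]
    nlinarith
  · intro y hy
    have hy0 : 0 < y := hm.trans_le hy.1
    have hl : HasDerivAt (fun T : ℝ => (Real.log T : ℂ)) ((y⁻¹ : ℝ) : ℂ) y :=
      (Real.hasDerivAt_log hy0.ne').ofReal_comp
    exact (hl.neg.mul_const s).cexp.hasDerivWithinAt
  · intro y hy
    have hy0 : 0 < y := hm.trans_le hy.1
    rw [norm_mul, norm_term s hy0, norm_mul, norm_neg, Complex.norm_real, Real.norm_of_nonneg (by positivity),
      ← Real.rpow_neg_one, ← mul_assoc, ← Real.rpow_add hy0, mul_comm, hC]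
    gcongr
    have e1 : y ^ (-s.re + -1) ≤ m ^ (-s.re + -1) :=
      Real.rpow_le_rpow_of_nonpos hm hy.1 (by linarith)
    refine e1.trans ?_
    rcases le_total 1 m with h | h
    · have := Real.rpow_le_rpow_of_exponent_le h (show -s.re + -1 ≤ -(3/2) by linarith)
      have : 0 ≤ m ^ (-(5 / 2) : ℝ) := by positivity
      linarith
    · have := Real.rpow_le_rpow_of_exponent_ge hm h (show -(5/2) ≤ -s.re + -1 by linarith)
      have : 0 ≤ m ^ (-(3 / 2) : ℝ) := by positivity
      linarith

lemma step_bound (s : ℂ) (h1 : 1 / 2 ≤ s.re) (h2 : s.re ≤ 3 / 2) {m : ℝ} (hm : 0 < m) :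
    ‖Complex.exp (-(Real.log (m + 1) : ℂ) * s)
      - (Eint (Real.log (m + 1)) (1 - s) - Eint (Real.log m) (1 - s))‖
      ≤ ‖s‖ * (m ^ (-(3 / 2) : ℝ) + m ^ (-(5 / 2) : ℝ)) := by
  set c := Complex.exp (-(Real.log (m + 1) : ℂ) * s) with hc
  have key := (convex_Icc m (m + 1)).norm_image_sub_le_of_norm_hasDerivWithin_le
    (f := fun y : ℝ => Eint (Real.log y) (1 - s) - (y : ℂ) * c)
    (f' := fun y : ℝ => Complex.exp (-(Real.log y : ℂ) * s) - 1 * c)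
    (C := ‖s‖ * (m ^ (-(3 / 2) : ℝ) + m ^ (-(5 / 2) : ℝ)))
    (x := m) (y := m + 1) ?_ ?_ (by constructor <;> linarith) (by constructor <;> linarith)
  · rw [← norm_neg]
    convert key using 1
    · congr 1; push_cast; ring
    · simp
  · intro y hy
    have hy0 : 0 < y := hm.trans_le hy.1
    exact ((Eint_deriv s hy0).sub ((HasDerivAt.ofReal_comp (hasDerivAt_id y)).mul_const c)).hasDerivWithinAt
  · intro y hy
    rw [one_mul]
    exact term_diff_bound s h1 h2 hm hy

noncomputable def HH (a : ℝ) (N : ℕ) (s : ℂ) : ℂ :=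
  (∑ n ∈ Finset.range (N + 1), Complex.exp (-(Real.log (a + n) : ℂ) * s))
    - Eint (Real.log (a + N)) (1 - s)

noncomputable def dd (a : ℝ) (n : ℕ) (s : ℂ) : ℂ :=
  Complex.exp (-(Real.log (a + n + 1) : ℂ) * s)
      - (Eint (Real.log (a + n + 1)) (1 - s) - Eint (Real.log (a + n)) (1 - s))

lemma HH_eq (a : ℝ) (N : ℕ) (s : ℂ) :
    HH a N s = HH a 0 s + ∑ n ∈ Finset.range N, dd a n s := by
  induction N with
  | zero => simp
  | succ N ih =>
    rw [Finset.sum_range_succ, ← add_assoc, ← ih, HH, HH, dd, Finset.sum_range_succ _ (N + 1)]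
    push_cast
    rw [← add_assoc]
    ring

lemma HH_diff (a : ℝ) (N : ℕ) : Differentiable ℂ (HH a N) := by
  unfold HH
  have := Eint_diff (Real.log (a + N))
  fun_prop

lemma HH_iter (a : ℝ) (ha : 0 < a) (N p : ℕ) : iteratedDeriv p (HH a N) 1 =
    (((-1) ^ p * ((∑ n ∈ Finset.range (N + 1), (Real.log (a + (n : ℝ))) ^ p / (a + (n : ℝ))) -
            (Real.log (a + (N : ℝ))) ^ (p + 1) / ((p : ℝ) + 1)) : ℝ) : ℂ) := by
  have hE : ContDiff ℂ p (fun s => Eint (Real.log (a + N)) (1 - s)) :=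
    Differentiable.contDiff (by have := Eint_diff (Real.log (a + N)); fun_prop)
  unfold HH
  rw [iteratedDeriv_fun_sub (ContDiff.contDiffAt (by fun_prop)) hE.contDiffAt,
    iteratedDeriv_fun_sum (fun i _ => ContDiff.contDiffAt (by fun_prop)),
    iteratedDeriv_comp_const_sub]
  simp only [sub_self, Eint_iter, iteratedDeriv_cexp_const_mul, mul_one]
  push_cast
  rw [mul_sub, Finset.mul_sum, smul_eq_mul]
  congr 1
  refine Finset.sum_congr rfl fun n _ => ?_
  have hT : 0 < a + n := by positivity
  rw [neg_pow, Complex.exp_neg, ← Complex.ofReal_exp, Real.exp_log hT]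
  push_cast; rw [div_eq_mul_inv]; ring

lemma summ_rpow (a : ℝ) (ha : 0 < a) {r : ℝ} (hr : 1 < r) : Summable fun n : ℕ => (a + n) ^ (-r) := by
  refine ((Real.summable_one_div_nat_add_rpow a r).2 hr).congr fun n => ?_
  have hT : 0 < a + n := by positivity
  rw [add_comm, abs_of_pos hT, Real.rpow_neg hT.le, one_div]

lemma HH_tendsto (a : ℝ) (ha : 0 < a) (s : ℂ) (hs : 1 < s.re) : Tendsto (fun N => HH a N s) atTop
    (𝓝 ((∑' n : ℕ, 1 / ((a : ℂ) + (n : ℂ)) ^ s) - 1 / (s - 1))) := by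
  have hs1 : 1 - s ≠ 0 := by
    intro h
    have : s = 1 := by linear_combination -h
    rw [this] at hs; simp at hs
  have hs1' : s - 1 ≠ 0 := by
    intro h; apply hs1; linear_combination -h
  have hterm : ∀ n : ℕ, 1 / ((a : ℂ) + (n : ℂ)) ^ s = Complex.exp (-(Real.log (a + n) : ℂ) * s) := by
    intro n
    have hT : 0 < a + n := by positivity
    have hT0 : ((a : ℂ) + n) ≠ 0 := by exact_mod_cast hT.ne'
    rw [Complex.cpow_def_of_ne_zero hT0, Complex.ofReal_log hT.le, neg_mul, Complex.exp_neg, one_div]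
    push_cast; rfl
  simp only [hterm]
  refine Tendsto.sub ?_ ?_
  · have hsum : Summable fun n : ℕ => Complex.exp (-(Real.log (a + n) : ℂ) * s) := by
      apply Summable.of_norm
      refine (summ_rpow a ha hs).congr fun n => ?_
      rw [norm_term s (by positivity)]
    exact (tendsto_add_atTop_iff_nat 1).2 hsum.hasSum.tendsto_sum_nat
  · simp only [Eint_ne _ hs1]
    have h0 : Tendsto (fun N : ℕ => Complex.exp ((Real.log (a + N) : ℂ) * (1 - s))) atTop (𝓝 0) := by
      rw [tendsto_zero_iff_norm_tendsto_zero]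
      have : ∀ N : ℕ, ‖Complex.exp ((Real.log (a + N) : ℂ) * (1 - s))‖ = (a + N) ^ (-(s.re - 1)) := by
        intro N
        rw [Complex.norm_exp, Real.rpow_def_of_pos (by positivity)]; simp
      simp only [this]
      exact (tendsto_rpow_neg_atTop (by linarith)).comp
        (tendsto_atTop_add_const_left _ a tendsto_natCast_atTop_atTop)
    have := (h0.sub_const 1).div_const (1 - s)
    convert this using 2
    field_simp; ring

lemma iter_tendsto {U : Set ℂ} (hU : IsOpen U) (f : ℕ → ℂ → ℂ) (g : ℂ → ℂ)
    (hf : ∀ n, Differentiable ℂ (f n)) (h : TendstoLocallyUniformlyOn f g atTop U) (p : ℕ) :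
    TendstoLocallyUniformlyOn (fun n => iteratedDeriv p (f n)) (iteratedDeriv p g) atTop U := by
  induction p with
  | zero => simpa using h
  | succ p ih =>
    have := ih.deriv (Eventually.of_forall fun n =>
      (((hf n).contDiff (n := ⊤)).differentiable_iteratedDeriv p (by exact_mod_cast WithTop.coe_lt_top _)).differentiableOn) hU
    simp only [iteratedDeriv_succ]
    exact this

theorem stieltjes_constant_limit (a : ℝ) (ha : 0 < a) (p : ℕ) (hp : 1 ≤ p)
    (F : ℂ → ℂ) (hF : Differentiable ℂ F)
    (hFs : ∀ s : ℂ, 1 < s.re →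
      F s = (∑' n : ℕ, 1 / ((a : ℂ) + (n : ℂ)) ^ s) - 1 / (s - 1)) :
    ∃ L : ℝ,
      Tendsto (fun N : ℕ =>
          (∑ n ∈ Finset.range (N + 1), (Real.log (a + (n : ℝ))) ^ p / (a + (n : ℝ))) -
            (Real.log (a + (N : ℝ))) ^ (p + 1) / ((p : ℝ) + 1))
        atTop (𝓝 L) ∧
      (L : ℂ) = (-1) ^ p * iteratedDeriv p F 1 := by
  set U : Set ℂ := Metric.ball 1 (1 / 2) with hUdef
  have hU : IsOpen U := Metric.isOpen_ball
  have hUre : ∀ s ∈ U, 1 / 2 ≤ s.re ∧ s.re ≤ 3 / 2 ∧ ‖s‖ ≤ 2 := by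
    intro s hs
    rw [hUdef, mem_ball_iff_norm] at hs
    have h1 := (Complex.abs_re_le_norm (s - 1)).trans hs.le
    rw [abs_le] at h1
    simp only [Complex.sub_re, Complex.one_re] at h1
    have h2 : ‖s‖ ≤ ‖s - 1‖ + ‖(1 : ℂ)‖ := by simpa using norm_add_le (s - 1) 1
    rw [norm_one] at h2
    refine ⟨by linarith [h1.1], by linarith [h1.2], by linarith⟩
  set G : ℂ → ℂ := fun s => HH a 0 s + ∑' n, dd a n s with hG
  have hsum : Summable fun n : ℕ => 2 * ((a + n) ^ (-(3 / 2) : ℝ) + (a + n) ^ (-(5 / 2) : ℝ)) :=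
    ((summ_rpow a ha (by norm_num)).add (summ_rpow a ha (by norm_num))).mul_left 2
  have hunif : TendstoUniformlyOn (fun N => HH a N) G atTop U := by
    have h := tendstoUniformlyOn_tsum_nat (f := dd a) hsum (s := U) (fun n s hs => by
      obtain ⟨h1, h2, h3⟩ := hUre s hs
      refine (step_bound s h1 h2 (m := a + n) (by positivity)).trans ?_
      gcongr)
    rw [Metric.tendstoUniformlyOn_iff] at h ⊢
    intro ε hε
    filter_upwards [h ε hε] with N hN s hs
    have := hN s hs
    rw [HH_eq, hG]
    simpa using this
  have hloc := hunif.tendstoLocallyUniformlyOn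
  have hGd : DifferentiableOn ℂ G U :=
    hloc.differentiableOn (Eventually.of_forall fun N => (HH_diff a N).differentiableOn) hU
  have hs0 : (5 / 4 : ℂ) ∈ U := by
    rw [hUdef, mem_ball_iff_norm]; norm_num
  have hFG : Set.EqOn G F U := by
    refine (hGd.analyticOnNhd hU).eqOn_of_preconnected_of_eventuallyEq
      (hF.differentiableOn.analyticOnNhd hU) (convex_ball _ _).isPreconnected hs0 ?_
    have hopen : IsOpen {s : ℂ | 1 < s.re} := isOpen_lt continuous_const Complex.continuous_re
    filter_upwards [hU.mem_nhds hs0, hopen.mem_nhds (show (1:ℝ) < (5 / 4 : ℂ).re by norm_num)] with s hs hs'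
    rw [hFs s hs']
    exact tendsto_nhds_unique (hunif.tendsto_at hs) (HH_tendsto a ha s hs')
  have hlocF : TendstoLocallyUniformlyOn (fun N => HH a N) F atTop U := hloc.congr_right hFG
  have hlim := (iter_tendsto hU _ F (HH_diff a) hlocF p).tendsto_at
    (show (1 : ℂ) ∈ U from Metric.mem_ball_self (by norm_num))
  simp only [HH_iter a ha] at hlim
  have hlim2 := hlim.const_mul ((-1 : ℂ) ^ p)
  set S : ℕ → ℝ := fun N : ℕ =>
          (∑ n ∈ Finset.range (N + 1), (Real.log (a + (n : ℝ))) ^ p / (a + (n : ℝ))) -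
            (Real.log (a + (N : ℝ))) ^ (p + 1) / ((p : ℝ) + 1) with hS
  have hlim3 : Tendsto (fun N => ((S N : ℝ) : ℂ)) atTop (𝓝 ((-1) ^ p * iteratedDeriv p F 1)) := by
    refine hlim2.congr fun N => ?_
    have h1 : ((-1 : ℂ) ^ p) * (-1) ^ p = 1 := by rw [← mul_pow]; simp
    rw [Complex.ofReal_mul, ← mul_assoc, Complex.ofReal_pow, Complex.ofReal_neg,
      Complex.ofReal_one, h1, one_mul]
  have hre := (Complex.continuous_re.tendsto _).comp hlim3
  refine ⟨((-1 : ℂ) ^ p * iteratedDeriv p F 1).re, by simpa [Function.comp_def] using hre, ?_⟩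
  refine tendsto_nhds_unique ?_ hlim3
  exact (Complex.continuous_ofReal.tendsto _).comp (by simpa [Function.comp_def] using hre)
end

section
/- For every real a > 0, the improper integral ∫_0^∞ sin(ax)/(e^{2πx} − 1) dx converges and 2·∫_0^∞ sin(ax)/(e^{2πx} − 1) dx = 1/(e^a − 1) − 1/a + 1/2 = (1/2)·coth(a/2) − 1/a. -/
open Real Filter MeasureTheory Topology

lemma aux_exp_lower {y : ℝ} (hy : 0 < y) : y * Real.exp (y / 2) ≤ Real.exp y - 1 := by
  have h1 : y / 2 ≤ Real.sinh (y / 2) := Real.self_le_sinh_iff.2 (by positivity)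
  have h2 : Real.exp y - 1 = 2 * Real.exp (y / 2) * Real.sinh (y / 2) := by
    rw [Real.sinh_eq]
    have : Real.exp y = Real.exp (y / 2) * Real.exp (y / 2) := by
      rw [← Real.exp_add]; ring_nf
    have h3 : Real.exp (y / 2) * Real.exp (-(y / 2)) = 1 := by
      rw [← Real.exp_add]; simp
    rw [this]; linear_combination h3
  rw [h2]
  nlinarith [Real.exp_pos (y / 2)]

lemma aux_integrable (a : ℝ) (ha : 0 < a) :
    IntegrableOn (fun x : ℝ => Real.sin (a * x) / (Real.exp (2 * π * x) - 1))
      (Set.Ioi 0) := by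
  have hb : IntegrableOn (fun x : ℝ => a / (2 * π) * Real.exp (-π * x)) (Set.Ioi 0) :=
    (integrableOn_exp_mul_Ioi (by simp [Real.pi_pos]) 0).const_mul _
  refine Integrable.mono' hb ?_ ?_
  · exact Measurable.aestronglyMeasurable (by fun_prop)
  · rw [ae_restrict_iff' measurableSet_Ioi]
    refine ae_of_all _ fun x hx => ?_
    have hx : 0 < x := hx
    have hpi := Real.pi_pos
    have h0 : 0 < 2 * π * x := by positivity
    have h1 := aux_exp_lower h0
    have h2 : 0 < 2 * π * x * Real.exp (2 * π * x / 2) := by positivity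
    rw [norm_div, Real.norm_eq_abs, Real.norm_eq_abs, abs_of_pos (a := _ - 1) (by linarith)]
    have h3 : |Real.sin (a * x)| ≤ a * x := by
      have := Real.abs_sin_le_abs (x := a * x)
      rwa [abs_of_pos (a := a * x) (by positivity)] at this
    calc _ ≤ (a * x) / (2 * π * x * Real.exp (2 * π * x / 2)) := by gcongr
      _ = _ := by
        rw [show 2 * π * x / 2 = π * x by ring, neg_mul, Real.exp_neg]
        field_simp

lemma aux_hasSum {x : ℝ} (hx : 0 < x) (c : ℝ) :
    HasSum (fun n : ℕ => c * Real.exp (-(2 * π * (n + 1)) * x))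
      (c / (Real.exp (2 * π * x) - 1)) := by
  have h0 : 0 < 2 * π * x := by have := Real.pi_pos; positivity
  have h1 : Real.exp (-(2 * π * x)) < 1 := by simpa using h0
  have h := (hasSum_geometric_of_lt_one (Real.exp_pos _).le h1).mul_left
    (c * Real.exp (-(2 * π * x)))
  have hE : 1 < Real.exp (2 * π * x) := by simpa using h0
  convert! h using 1
  · funext n
    rw [← Real.exp_nat_mul, mul_assoc c, ← Real.exp_add]
    ring_nf
  · rw [Real.exp_neg]
    have : Real.exp (2 * π * x) - 1 ≠ 0 := by linarith
    field_simp

lemma aux_term (a b : ℝ) (hb : 0 < b) :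
    ∫ x in Set.Ioi (0 : ℝ), Real.sin (a * x) * Real.exp (-b * x) = a / (a ^ 2 + b ^ 2) := by
  have hre : (-(b : ℂ) + a * Complex.I).re < 0 := by simpa using hb
  have h := integral_exp_mul_complex_Ioi hre 0
  have hi := integrableOn_exp_mul_complex_Ioi hre 0
  have h2 := integral_im hi
  rw [h] at h2
  convert! h2 using 1
  · congr 1
    funext x
    simp [Complex.exp_im, mul_comm]
  · simp [Complex.div_im, Complex.normSq_apply]
    ring

lemma aux_series (a : ℝ) (ha : 0 < a) :
    HasSum (fun n : ℕ => a / (a ^ 2 + (2 * π * (n + 1)) ^ 2))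
      ((1 / (Real.exp a - 1) - 1 / a + 1 / 2) / 2) := by
  have hpi := Real.pi_pos
  have hpc : (π : ℂ) ≠ 0 := by exact_mod_cast hpi.ne'
  have hac : (a : ℂ) ≠ 0 := by exact_mod_cast ha.ne'
  set z : ℂ := ((a / (2 * π) : ℝ) : ℂ) * Complex.I with hz
  have hzi : z.im = a / (2 * π) := by rw [hz, Complex.im_ofReal_mul, Complex.I_im, mul_one]
  have hzm : z ∈ Complex.integerComplement := by
    rintro ⟨k, hk⟩
    have : z.im = 0 := by rw [← hk]; simp
    rw [hzi] at this
    have : 0 < a / (2 * π) := by positivity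
    linarith
  have hs := (summable_cotTerm hzm).hasSum
  have hv : ∑' n, cotTerm z n = π * Complex.cot (π * z) - 1 / z := (cot_series_rep' hzm).symm
  rw [hv] at hs
  have hs2 := hs.mul_left (Complex.I / (4 * π))
  rw [← Complex.hasSum_ofReal]
  have hE : 1 < Real.exp a := by simpa using ha
  have hEc : (Complex.exp a - 1) ≠ 0 := by
    rw [← Complex.ofReal_exp]
    exact_mod_cast (by linarith : Real.exp a - 1 ≠ 0)
  convert! hs2 using 1
  · funext n
    rw [cotTerm_identity hzm]
    have hq : (z + (n + 1)) * (z - (n + 1)) = -((a ^ 2 + (2 * π * (n + 1)) ^ 2) / (4 * π ^ 2)) := by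
      rw [hz]
      push_cast
      field_simp
      ring_nf
      simp only [Complex.I_sq]
      ring
    rw [hq, hz]
    have : ((a : ℂ) ^ 2 + (2 * π * (n + 1)) ^ 2) ≠ 0 := by
      have : a ^ 2 + (2 * π * (n + 1)) ^ 2 ≠ 0 := by positivity
      exact_mod_cast this
    push_cast
    field_simp
    simp only [Complex.I_sq]
    ring
  · rw [Complex.cot_pi_eq_exp_ratio]
    have : 2 * π * Complex.I * z = -(a : ℂ) := by
      rw [hz]; push_cast; field_simp; simp
    rw [this, Complex.exp_neg, hz]
    have he := Complex.exp_ne_zero (a : ℂ)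
    push_cast
    have h1 : 1 - (Complex.exp a)⁻¹ = (Complex.exp a - 1) / Complex.exp a := by field_simp
    rw [h1]
    have hI := Complex.I_ne_zero
    field_simp
    ring

/-- Legendre's relation: for every real `a > 0`, `∫_0^∞ sin(ax)/(e^{2πx} − 1) dx`
converges and `2 ∫_0^∞ sin(ax)/(e^{2πx} − 1) dx = 1/(e^a − 1) − 1/a + 1/2
= (1/2) coth(a/2) − 1/a`. -/
theorem integral_sin_div_exp_sub_one (a : ℝ) (ha : 0 < a) :
    IntegrableOn (fun x : ℝ => Real.sin (a * x) / (Real.exp (2 * π * x) - 1))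
      (Set.Ioi 0) ∧
    2 * ∫ x in Set.Ioi (0 : ℝ), Real.sin (a * x) / (Real.exp (2 * π * x) - 1) =
      1 / (Real.exp a - 1) - 1 / a + 1 / 2 ∧
    1 / (Real.exp a - 1) - 1 / a + 1 / 2 =
      (1 / 2) * (Real.cosh (a / 2) / Real.sinh (a / 2)) - 1 / a := by
  have hint := aux_integrable a ha
  have hpi := Real.pi_pos
  refine ⟨hint, ?_, ?_⟩
  · have key : HasSum (fun n : ℕ => ∫ x in Set.Ioi (0 : ℝ),
        Real.sin (a * x) * Real.exp (-(2 * π * (n + 1)) * x))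
        (∫ x in Set.Ioi (0 : ℝ), Real.sin (a * x) / (Real.exp (2 * π * x) - 1)) := by
      refine hasSum_integral_of_dominated_convergence
        (fun n x => |Real.sin (a * x)| * Real.exp (-(2 * π * (n + 1)) * x)) ?_ ?_ ?_ ?_ ?_
      · intro n
        exact Measurable.aestronglyMeasurable (by fun_prop)
      · intro n
        refine ae_of_all _ fun x => ?_
        simp
      · rw [ae_restrict_iff' measurableSet_Ioi]
        exact ae_of_all _ fun x hx => (aux_hasSum hx _).summable
      · refine (hint.norm).congr ?_
        rw [EventuallyEq, ae_restrict_iff' measurableSet_Ioi]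
        refine ae_of_all _ fun x hx => ?_
        rw [(aux_hasSum hx _).tsum_eq, norm_div, Real.norm_eq_abs, Real.norm_eq_abs,
          abs_of_nonneg (a := _ - 1)]
        have hx : 0 < x := hx
        have : 0 ≤ 2 * π * x := by positivity
        simpa using this
      · rw [ae_restrict_iff' measurableSet_Ioi]
        exact ae_of_all _ fun x hx => aux_hasSum hx _
    have h2 := aux_series a ha
    have h3 : (fun n : ℕ => ∫ x in Set.Ioi (0 : ℝ),
        Real.sin (a * x) * Real.exp (-(2 * π * (n + 1)) * x)) =
        fun n : ℕ => a / (a ^ 2 + (2 * π * (n + 1)) ^ 2) := by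
      funext n
      exact aux_term a _ (by positivity)
    rw [h3] at key
    rw [key.unique h2]
    ring
  · have hE : 1 < Real.exp (a / 2) := by simpa using ha
    have h1 : Real.exp a = Real.exp (a / 2) ^ 2 := by
      rw [← Real.exp_nat_mul]; congr 1; push_cast; ring
    rw [Real.cosh_eq, Real.sinh_eq, Real.exp_neg, h1]
    set E := Real.exp (a / 2)
    have hE0 : E ≠ 0 := by positivity
    have h2 : E ^ 2 - 1 ≠ 0 := by nlinarith
    have h3 : (E - E⁻¹) = (E ^ 2 - 1) / E := by field_simp
    rw [h3]
    field_simp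
    ring
end

section
/- For every complex s with Re(s) > 1 and every real a > 0, the Hurwitz zeta function satisfies ζ(s, a) = 1/(2a^s) + 1/((s−1)·a^{s−1}) + 2·∑_{n=1}^∞ ∫_0^∞ cos(2πnx)/(a+x)^s dx, where each improper integral converges and the series over n converges. -/
open Real Filter MeasureTheory Topology

/-- The shifted power function `(a + x)^(-s)`. -/
noncomputable def hzPow (a : ℝ) (s : ℂ) (x : ℝ) : ℂ := ((a + x : ℝ) : ℂ) ^ (-s)

lemma hzPow_norm (a : ℝ) (s : ℂ) {x : ℝ} (hx : 0 < a + x) :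
    ‖hzPow a s x‖ = (a + x) ^ (-s.re) := by
  rw [hzPow, Complex.norm_cpow_eq_rpow_re_of_pos hx, Complex.neg_re]

lemma hzPow_hasDerivAt (a : ℝ) (s : ℂ) (hs : s ≠ 0) {x : ℝ} (hx : 0 < a + x) :
    HasDerivAt (hzPow a s) (-s * hzPow a (s + 1) x) x := by
  have h1 := hasDerivAt_ofReal_cpow_const (x := a + x) hx.ne' (r := -s) (neg_ne_zero.2 hs)
  have h2 := h1.scomp x ((hasDerivAt_id x).const_add a)
  refine h2.congr_deriv ?_
  simp only [hzPow, one_smul]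
  congr 2
  ring

lemma hzPow_integrable (a : ℝ) (ha : 0 < a) (s : ℂ) (hs : 1 < s.re) :
    IntegrableOn (hzPow a s) (Set.Ioi 0) := by
  have h := integrableOn_add_rpow_Ioi_of_lt (a := -s.re) (c := 0) (m := a) (by linarith)
    (by linarith)
  refine Integrable.mono' h ?_ ?_
  · refine ContinuousOn.aestronglyMeasurable (fun x hx ↦ ?_) measurableSet_Ioi
    have hx' : (0:ℝ) < x := hx
    exact (hzPow_hasDerivAt a s (by rintro rfl; simp at hs; linarith)
      (by linarith)).continuousAt.continuousWithinAt
  · refine (ae_restrict_iff' measurableSet_Ioi).2 (Eventually.of_forall fun x hx ↦ ?_)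
    have hx' : (0:ℝ) < x := hx
    rw [hzPow_norm a s (by linarith), add_comm]

lemma hzPow_tendsto (a : ℝ) (s : ℂ) (hs : 1 < s.re) :
    Tendsto (hzPow a s) atTop (𝓝 0) := by
  rw [tendsto_zero_iff_norm_tendsto_zero]
  have h := (tendsto_rpow_neg_atTop (y := s.re) (by linarith)).comp
    (tendsto_atTop_add_const_left atTop a tendsto_id)
  refine h.congr' ?_
  filter_upwards [eventually_gt_atTop (-a)] with x hx
  rw [hzPow_norm a s (by linarith)]
  rfl

lemma hzPow_cos_integrable (a : ℝ) (ha : 0 < a) (s : ℂ) (hs : 1 < s.re) (w : ℝ) :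
    IntegrableOn (fun x ↦ (Real.cos (w * x) : ℂ) * hzPow a s x) (Set.Ioi 0) := by
  refine (hzPow_integrable a ha s hs).bdd_mul (c := 1) ?_ ?_
  · exact (by fun_prop : Continuous fun x : ℝ ↦ (Real.cos (w * x) : ℂ)).aestronglyMeasurable
  · refine Eventually.of_forall fun x ↦ ?_
    rw [Complex.norm_real]
    exact Real.abs_cos_le_one _

lemma hzPow_cos_norm_le (a : ℝ) (ha : 0 < a) (s : ℂ) (hs : 1 < s.re) (w : ℝ) :
    ‖∫ x in Set.Ioi (0:ℝ), (Real.cos (w * x) : ℂ) * hzPow a s x‖ ≤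
      ∫ x in Set.Ioi (0:ℝ), ‖hzPow a s x‖ := by
  refine norm_integral_le_of_norm_le (hzPow_integrable a ha s hs).norm ?_
  refine Eventually.of_forall fun x ↦ ?_
  rw [norm_mul, Complex.norm_real]
  exact mul_le_of_le_one_left (norm_nonneg _) (Real.abs_cos_le_one _)

lemma hzPow_cos_parts (a : ℝ) (ha : 0 < a) (s : ℂ) (hs : 1 < s.re) (w : ℝ) (hw : w ≠ 0) :
    ∫ x in Set.Ioi (0:ℝ), (Real.cos (w * x) : ℂ) * hzPow a s x =
      (s * hzPow a (s + 1) 0 - s * (s + 1) *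
        ∫ x in Set.Ioi (0:ℝ), (Real.cos (w * x) : ℂ) * hzPow a (s + 1 + 1) x) / (w:ℂ) ^ 2 := by
  have hwc : (w : ℂ) ≠ 0 := by exact_mod_cast hw
  have hs0 : s ≠ 0 := by rintro rfl; simp at hs; linarith
  have hs1 : s + 1 ≠ 0 := by
    intro h
    have := congrArg Complex.re h
    simp at this; linarith
  have i0 := hzPow_cos_integrable a ha s hs w
  have i2 := hzPow_cos_integrable a ha (s + 1 + 1) (by simp; linarith) w
  have key := integral_Ioi_of_hasDerivAt_of_tendsto' (a := (0:ℝ)) (m := (0:ℂ))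
    (f := fun x : ℝ ↦ (Real.sin (w * x) : ℂ) * hzPow a s x / w
      - s * ((Real.cos (w * x) : ℂ) * hzPow a (s + 1) x) / (w:ℂ) ^ 2)
    (f' := fun x : ℝ ↦ (Real.cos (w * x) : ℂ) * hzPow a s x
      + s * (s + 1) / (w:ℂ) ^ 2 * ((Real.cos (w * x) : ℂ) * hzPow a (s + 1 + 1) x)) ?_ ?_ ?_
  · rw [integral_add i0 (i2.const_mul _), integral_const_mul] at key
    simp at key
    simp only [Complex.ofReal_cos, Complex.ofReal_mul]
    field_simp at key ⊢
    linear_combination key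
  · intro x hx
    have hx' : (0:ℝ) ≤ x := hx
    have hp : 0 < a + x := by linarith
    have hl : HasDerivAt (fun x : ℝ ↦ w * x) w x := by simpa using (hasDerivAt_id x).const_mul w
    have dc := ((Real.hasDerivAt_cos (w * x)).comp x hl).ofReal_comp
    have ds := ((Real.hasDerivAt_sin (w * x)).comp x hl).ofReal_comp
    have d0 := hzPow_hasDerivAt a s hs0 hp
    have d1 := hzPow_hasDerivAt a (s + 1) hs1 hp
    have := ((ds.mul d0).div_const (w:ℂ)).sub (((dc.mul d1).const_mul s).div_const ((w:ℂ)^2))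
    refine this.congr_deriv ?_
    simp only [Function.comp]
    push_cast
    field_simp
    ring
  · exact i0.add (i2.const_mul _)
  · have b1 : Tendsto (fun x : ℝ ↦ (Real.sin (w * x) : ℂ) * hzPow a s x) atTop (𝓝 0) := by
      refine squeeze_zero_norm (fun x ↦ ?_) ((hzPow_tendsto a s hs).norm.trans (by simp))
      rw [norm_mul, Complex.norm_real]
      exact mul_le_of_le_one_left (norm_nonneg _) (Real.abs_sin_le_one _)
    have b2 : Tendsto (fun x : ℝ ↦ (Real.cos (w * x) : ℂ) * hzPow a (s + 1) x) atTop (𝓝 0) := by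
      refine squeeze_zero_norm (fun x ↦ ?_)
        ((hzPow_tendsto a (s + 1) (by simp; linarith)).norm.trans (by simp))
      rw [norm_mul, Complex.norm_real]
      exact mul_le_of_le_one_left (norm_nonneg _) (Real.abs_cos_le_one _)
    simpa using (b1.div_const (w:ℂ)).sub ((b2.const_mul s).div_const ((w:ℂ)^2))

lemma hzPow_cos_summable (a : ℝ) (ha : 0 < a) (s : ℂ) (hs : 1 < s.re) :
    Summable (fun n : ℕ ↦ ∫ x in Set.Ioi (0:ℝ),
      (Real.cos (2 * π * n * x) : ℂ) * hzPow a s x) := by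
  set K : ℝ := ‖s * hzPow a (s + 1) 0‖ + ‖s * (s + 1)‖ *
    ∫ x in Set.Ioi (0:ℝ), ‖hzPow a (s + 1 + 1) x‖
  rw [← summable_nat_add_iff 1]
  refine Summable.of_norm_bounded (g := fun n : ℕ ↦ K * (1 / ((n + 1 : ℕ) : ℝ) ^ 2)) ?_ ?_
  · exact ((summable_nat_add_iff 1).2
      (Real.summable_one_div_nat_pow.2 (by norm_num : 1 < 2))).mul_left _
  · intro n
    have hn : (0:ℝ) < ((n + 1 : ℕ) : ℝ) := by positivity
    have hpi := Real.pi_gt_three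
    rw [hzPow_cos_parts a ha s hs _ (by positivity), norm_div, norm_pow, Complex.norm_real,
      Real.norm_of_nonneg (by positivity), mul_one_div]
    have hK : ‖s * hzPow a (s + 1) 0 - s * (s + 1) * ∫ x in Set.Ioi (0:ℝ),
        (Real.cos (2 * π * ((n + 1 : ℕ) : ℝ) * x) : ℂ) * hzPow a (s + 1 + 1) x‖ ≤ K := by
      refine (norm_sub_le _ _).trans (add_le_add le_rfl ?_)
      rw [norm_mul]
      exact mul_le_mul_of_nonneg_left
        (hzPow_cos_norm_le a ha _ (by simp; linarith) _) (norm_nonneg _)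
    refine div_le_div₀ ((norm_nonneg _).trans hK) hK (by positivity) ?_
    gcongr
    nlinarith

lemma hzPow_even_cont (a : ℝ) (ha : 0 < a) (s : ℂ) (hs : 1 < s.re) :
    Continuous (fun x : ℝ ↦ hzPow a s |x|) := by
  rw [continuous_iff_continuousAt]
  intro x
  have := (hzPow_hasDerivAt a s (by rintro rfl; simp at hs; linarith) (x := |x|)
    (by positivity)).continuousAt
  exact ContinuousAt.comp (f := fun x : ℝ ↦ |x|) this continuous_abs.continuousAt

lemma hzPow_even_isBigO (a : ℝ) (ha : 0 < a) (s : ℂ) (hs : 1 < s.re) :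
    (fun x : ℝ ↦ hzPow a s |x|) =O[cocompact ℝ] (fun x : ℝ ↦ |x| ^ (-s.re)) := by
  refine Asymptotics.IsBigO.of_bound 1 ?_
  have h0 : ∀ᶠ x : ℝ in cocompact ℝ, x ≠ 0 := by
    have := (isCompact_singleton (x := (0:ℝ))).compl_mem_cocompact
    filter_upwards [this] with x hx
    simpa using hx
  filter_upwards [h0] with x hx
  have hx' : 0 < |x| := abs_pos.2 hx
  rw [hzPow_norm a s (by positivity), one_mul, Real.norm_of_nonneg (by positivity)]
  exact Real.rpow_le_rpow_of_nonpos hx' (by linarith) (by linarith)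

open FourierTransform in
lemma hzPow_fourier (a : ℝ) (ha : 0 < a) (s : ℂ) (hs : 1 < s.re) (w : ℝ) :
    𝓕 (fun x : ℝ ↦ hzPow a s |x|) w =
      2 * ∫ x in Set.Ioi (0:ℝ), (Real.cos (2 * π * w * x) : ℂ) * hzPow a s x := by
  rw [Real.fourier_real_eq_integral_exp_smul]
  have ib : ∀ t : ℝ, IntegrableOn (fun x : ℝ ↦ Complex.exp (((t * x : ℝ) : ℂ) * Complex.I)
      * hzPow a s |x|) (Set.Ioi 0) := by
    intro t
    have h0 : IntegrableOn (fun x : ℝ ↦ hzPow a s |x|) (Set.Ioi 0) :=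
      (hzPow_integrable a ha s hs).congr_fun (fun x hx ↦ by
        simp only [abs_of_pos (show (0:ℝ) < x from hx)]) measurableSet_Ioi
    refine h0.bdd_mul (c := 1) ?_ ?_
    · exact (by fun_prop : Continuous fun x : ℝ ↦
        Complex.exp (((t * x : ℝ) : ℂ) * Complex.I)).aestronglyMeasurable
    · refine Eventually.of_forall fun x ↦ ?_
      rw [Complex.norm_exp_ofReal_mul_I]
  set F : ℝ → ℂ := fun v ↦ Complex.exp (((-2 * π * v * w : ℝ) : ℂ) * Complex.I) • hzPow a s |v|
    with hF
  have i1 : IntegrableOn F (Set.Ioi 0) := by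
    refine (ib (-2 * π * w)).congr_fun (fun x _ ↦ ?_) measurableSet_Ioi
    simp only [hF, smul_eq_mul]
    congr 4; ring
  have i2 : IntegrableOn (fun x ↦ F (-x)) (Set.Ioi 0) := by
    refine (ib (2 * π * w)).congr_fun (fun x _ ↦ ?_) measurableSet_Ioi
    simp only [hF, smul_eq_mul, abs_neg]
    congr 4; ring
  have i3 : IntegrableOn F (Set.Iic 0) := by
    rw [integrableOn_Iic_iff_integrableOn_Iio]
    have := i2.comp_neg
    simpa using this
  rw [← intervalIntegral.integral_Iic_add_Ioi i3 i1]
  have e := integral_comp_neg_Ioi 0 F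
  rw [neg_zero] at e
  rw [← e, ← integral_add i2 i1, ← integral_const_mul]
  refine setIntegral_congr_fun measurableSet_Ioi fun x hx ↦ ?_
  simp only [hF, smul_eq_mul, abs_neg, abs_of_pos (show (0:ℝ) < x from hx)]
  rw [← add_mul, ← mul_assoc, Complex.ofReal_cos, Complex.two_cos]
  congr 1
  congr 1 <;> congr 1 <;> push_cast <;> ring

lemma hzPow_integral (a : ℝ) (ha : 0 < a) (s : ℂ) (hs : 1 < s.re) :
    ∫ x in Set.Ioi (0:ℝ), hzPow a s x = 1 / ((s - 1) * (a : ℂ) ^ (s - 1)) := by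
  have hs1 : s - 1 ≠ 0 := by
    intro h
    have := congrArg Complex.re h
    simp at this; linarith
  have key := (measurePreserving_add_left volume a).setIntegral_preimage_emb
    (measurableEmbedding_addLeft a) (fun y : ℝ ↦ (y : ℂ) ^ (-s)) (Set.Ioi a)
  have hpre : (fun x : ℝ ↦ a + x) ⁻¹' Set.Ioi a = Set.Ioi 0 := by
    ext x; simp
  rw [hpre, integral_Ioi_cpow_of_lt (by simpa using hs) ha] at key
  have e : -s + 1 = -(s - 1) := by ring
  rw [e, Complex.cpow_neg] at key
  refine key.trans ?_
  rw [neg_div_neg_eq, div_eq_mul_inv, one_div, mul_inv, mul_comm]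

lemma hzPow_eq (a : ℝ) (s : ℂ) (x : ℝ) : hzPow a s x = 1 / ((a : ℂ) + (x : ℂ)) ^ s := by
  rw [hzPow, Complex.cpow_neg, one_div, Complex.ofReal_add]

lemma hzPow_nat_summable (a : ℝ) (ha : 0 < a) (s : ℂ) (hs : 1 < s.re) :
    Summable (fun n : ℕ ↦ hzPow a s n) := by
  refine summable_of_isBigO_nat (Real.summable_nat_rpow.2 (by linarith : -s.re < -1)) ?_
  refine Asymptotics.IsBigO.of_bound 1 ?_
  filter_upwards [eventually_gt_atTop 0] with n hn
  have hn' : (0:ℝ) < n := by exact_mod_cast hn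
  rw [hzPow_norm a s (by positivity), one_mul, Real.norm_of_nonneg (by positivity)]
  exact Real.rpow_le_rpow_of_nonpos hn' (by linarith) (by linarith)

/-- Summation over `ℤ` of an even function. -/
lemma hz_even_tsum (f : ℤ → ℂ) (g : ℕ → ℂ) (h1 : ∀ n : ℕ, f n = g n)
    (h2 : ∀ n : ℕ, f (-n) = g n) (hg : Summable g) :
    HasSum f (2 * ∑' n, g n - g 0) := by
  have := HasSum.of_nat_of_neg (f := f) (g := ∑' n, g n) (g' := ∑' n, g n)
    (by simpa [h1] using hg.hasSum) (by simpa [h2] using hg.hasSum)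
  have h0 := h1 0
  simp only [Nat.cast_zero] at h0
  rw [h0, ← two_mul] at this
  exact this

open FourierTransform in
lemma hzPow_main (a : ℝ) (ha : 0 < a) (s : ℂ) (hs : 1 < s.re) :
    2 * (∑' n : ℕ, hzPow a s n) - hzPow a s 0 =
      2 * (∑' n : ℕ, 2 * ∫ x in Set.Ioi (0:ℝ), (Real.cos (2 * π * n * x) : ℂ) * hzPow a s x)
        - 2 * ∫ x in Set.Ioi (0:ℝ), hzPow a s x := by
  have hF := hz_even_tsum (fun n : ℤ ↦ 𝓕 (fun x : ℝ ↦ hzPow a s |x|) (n : ℝ))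
    (fun n : ℕ ↦ 2 * ∫ x in Set.Ioi (0:ℝ), (Real.cos (2 * π * n * x) : ℂ) * hzPow a s x)
    (fun n ↦ by simp only [hzPow_fourier a ha s hs]; simp)
    (fun n ↦ by simp only [hzPow_fourier a ha s hs]; simp)
    ((hzPow_cos_summable a ha s hs).mul_left 2)
  have hS := hz_even_tsum (fun n : ℤ ↦ hzPow a s |(n : ℝ)|) (fun n : ℕ ↦ hzPow a s n)
    (fun n ↦ by simp) (fun n ↦ by simp) (hzPow_nat_summable a ha s hs)
  have P := Real.tsum_eq_tsum_fourier_of_rpow_decay_of_summable (hzPow_even_cont a ha s hs) hs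
    (hzPow_even_isBigO a ha s hs) hF.summable 0
  simp only [zero_add, QuotientAddGroup.mk_zero, fourier_eval_zero, mul_one] at P
  rw [hS.tsum_eq, hF.tsum_eq] at P
  simpa using P

theorem hurwitzZeta_eq_tsum_integral (s : ℂ) (hs : 1 < s.re) (a : ℝ) (ha : 0 < a) :
    (∀ n : ℕ,
      IntegrableOn
        (fun x : ℝ => (Real.cos (2 * π * ((n : ℝ) + 1) * x) : ℂ) / ((a : ℂ) + (x : ℂ)) ^ s)
        (Set.Ioi 0)) ∧
    ∃ S : ℂ,
      HasSum (fun n : ℕ =>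
          ∫ x in Set.Ioi (0 : ℝ),
            (Real.cos (2 * π * ((n : ℝ) + 1) * x) : ℂ) / ((a : ℂ) + (x : ℂ)) ^ s) S ∧
      (∑' n : ℕ, 1 / ((a : ℂ) + (n : ℂ)) ^ s) =
        1 / (2 * (a : ℂ) ^ s) + 1 / ((s - 1) * (a : ℂ) ^ (s - 1)) + 2 * S := by
  have e : ∀ w : ℝ, (fun x : ℝ => (Real.cos (w * x) : ℂ) / ((a : ℂ) + (x : ℂ)) ^ s) =
      fun x : ℝ ↦ (Real.cos (w * x) : ℂ) * hzPow a s x := by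
    intro w; funext x; rw [hzPow_eq, mul_one_div]
  have hc := hzPow_cos_summable a ha s hs
  have m := hzPow_main a ha s hs
  rw [tsum_mul_left, hc.tsum_eq_zero_add, hzPow_integral a ha s hs] at m
  refine ⟨fun n ↦ ?_, ∑' n : ℕ, ∫ x in Set.Ioi (0 : ℝ),
    (Real.cos (2 * π * ((n + 1 : ℕ) : ℝ) * x) : ℂ) * hzPow a s x, ?_, ?_⟩
  · rw [e]
    exact hzPow_cos_integrable a ha s hs _
  · simp only [e]
    have := ((summable_nat_add_iff 1).2 hc).hasSum
    simpa only [Nat.cast_add, Nat.cast_one] using this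
  · have e2 : (∑' n : ℕ, 1 / ((a : ℂ) + (n : ℂ)) ^ s) = ∑' n : ℕ, hzPow a s n := by
      congr 1; funext n; rw [hzPow_eq]; simp
    have e3 : hzPow a s 0 = 1 / (a : ℂ) ^ s := by rw [hzPow_eq]; simp
    have e4 : ∫ x in Set.Ioi (0 : ℝ), (Real.cos (2 * π * ((0 : ℕ) : ℝ) * x) : ℂ) * hzPow a s x
        = 1 / ((s - 1) * (a : ℂ) ^ (s - 1)) := by
      rw [← hzPow_integral a ha s hs]; simp
    rw [e4, e3] at m
    rw [e2]
    have e5 : 1 / (2 * (a : ℂ) ^ s) = (1 / (a : ℂ) ^ s) / 2 := by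
      rw [div_div, mul_comm]
    rw [e5]
    linear_combination m / 2
end
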